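/- arXiv:math/0408309 — 5 statements merged into one kernel-verified Lean document; each statement's English description precedes it below -/
import Mathlib

section
/- For q ∈ ℚ ∪ {+∞} with lev(q) > 0, one has lev(LN(q)) < lev(q). -/
noncomputable section

open Complex MeasureTheory

/- ## Farey machinery -/

/-- The Farey sequence of level `n`, as a subset of the extended reals;
`⊥ = -∞ = -1/0`, `⊤ = ∞ = 1/0`. -/
def fareySet (n : ℕ) : Set EReal :=
  {⊥, ⊤, 0} ∪ {x : EReal | ∃ q : ℚ, x = ((q : ℝ) : EReal) ∧ q.num.natAbs ≤ n ∧ q.den ≤ n}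

/-- The level of an element of `ℚ ∪ {±∞}`. -/
def flev (x : EReal) : ℕ := sInf {n : ℕ | x ∈ fareySet n}

/-- The left neighbor map: the largest element of `F_{lev x}` strictly below `x`. -/
def fLN (x : EReal) : EReal := sSup {r : EReal | r ∈ fareySet (flev x) ∧ r < x}

/-- The length `L` of the left neighbor sequence: the least `L` with `LN^L q = -∞`. -/
def fL (x : EReal) : ℕ := sInf {L : ℕ | fLN^[L] x = ⊥}

/-- The members `y_l = LN^{L-l}(q)` of the left neighbor sequence `LNS(q)`. -/
def yseq (q : ℚ) (l : ℕ) : EReal := fLN^[fL ((q : ℝ) : EReal) - l] ((q : ℝ) : EReal)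

/-- The fraction `a/c` as an element of `ℚ ∪ {±∞}` (with `1/0 = ∞`, `-1/0 = -∞`). -/
def efrac (a c : ℤ) : EReal :=
  if c = 0 then (if 0 < a then ⊤ else ⊥) else ((((a : ℚ) / (c : ℚ) : ℚ) : ℝ) : EReal)

open Classical in
/-- The numerator of an element of `ℚ ∪ {±∞}` in lowest terms (`-∞ = -1/0`, `∞ = 1/0`). -/
def enum (x : EReal) : ℤ :=
  if x = ⊥ then -1
  else if x = ⊤ then 1
  else if h : ∃ q : ℚ, x = ((q : ℝ) : EReal) then h.choose.num else 0

open Classical in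
/-- The (nonnegative) denominator of an element of `ℚ ∪ {±∞}` in lowest terms. -/
def eden (x : EReal) : ℤ :=
  if x = ⊥ then 0
  else if x = ⊤ then 0
  else if h : ∃ q : ℚ, x = ((q : ℝ) : EReal) then (h.choose.den : ℤ) else 0

/-- The matrix `m_l = [[b_l, -a_l], [b_{l-1}, -a_{l-1}]]` from `M(q) = Σ_l m_l`. -/
def mMat (q : ℚ) (l : ℕ) : Matrix (Fin 2) (Fin 2) ℤ :=
  !![eden (yseq q l), -enum (yseq q l); eden (yseq q (l - 1)), -enum (yseq q (l - 1))]

/- ## Matrix groups -/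

abbrev SL2 := Matrix.SpecialLinearGroup (Fin 2) ℤ

/-- The Hecke congruence subgroup `Γ₀(n)` inside `SL₂(ℤ)`. -/
def Gam0 (n : ℕ) : Set SL2 := {g : SL2 | (n : ℤ) ∣ (g : Matrix (Fin 2) (Fin 2) ℤ) 1 0}

/-- `X_m`: upper triangular integer matrices `[[a,b],[0,d]]` with `ad = m`, `d > b ≥ 0`. -/
def Xset (m : ℕ) : Set (Matrix (Fin 2) (Fin 2) ℤ) :=
  {A | A 1 0 = 0 ∧ A 0 0 * A 1 1 = (m : ℤ) ∧ 0 ≤ A 0 1 ∧ A 0 1 < A 1 1}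

/-- `X_m` as a finite set. -/
def XF (m : ℕ) : Finset (Matrix (Fin 2) (Fin 2) ℤ) :=
  ((m.divisors ×ˢ Finset.range m).filter fun p => p.2 < p.1).image
    fun p => !![((m / p.1 : ℕ) : ℤ), (p.2 : ℤ); 0, (p.1 : ℤ)]

/-- Möbius action of an integer matrix on (a suitable part of) `ℂ`. -/
def moeb (g : Matrix (Fin 2) (Fin 2) ℤ) (z : ℂ) : ℂ :=
  ((g 0 0 : ℂ) * z + (g 0 1 : ℂ)) / ((g 1 0 : ℂ) * z + (g 1 1 : ℂ))

/-- `α : Fin μ → SL₂(ℤ)` is a full set of representatives of the right cosets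
`Γ₀(n) \ SL₂(ℤ)`. -/
def IsCosetReps (n : ℕ) {μ : ℕ} (α : Fin μ → SL2) : Prop :=
  (∀ g : SL2, ∃ j : Fin μ, ∃ γ ∈ Gam0 n, g = γ * α j) ∧
  (∀ j k : Fin μ, (∃ γ ∈ Gam0 n, α j = γ * α k) → j = k)

open Classical in
/-- The representation of `SL₂(ℤ)` induced from the trivial representation of `Γ₀(n)`:
a permutation matrix realization of the right regular representation. -/
def rho (n : ℕ) {μ : ℕ} (α : Fin μ → SL2) (g : SL2) : Matrix (Fin μ) (Fin μ) ℂ :=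
  fun i j => if α i * g * (α j)⁻¹ ∈ Gam0 n then 1 else 0

/- ## Analysis -/

/-- Partial derivative in the `x` (real) direction. -/
def pdx (f : ℂ → ℂ) (z : ℂ) : ℂ := deriv (fun x : ℝ => f (x + z.im * Complex.I)) z.re

/-- Partial derivative in the `y` (imaginary) direction. -/
def pdy (f : ℂ → ℂ) (z : ℂ) : ℂ := deriv (fun y : ℝ => f (z.re + y * Complex.I)) z.im

/-- The hyperbolic Laplacian `Δ = -y²(∂_x² + ∂_y²)`. -/
def laplace (f : ℂ → ℂ) (z : ℂ) : ℂ := -(z.im : ℂ) ^ 2 * (pdx (pdx f) z + pdy (pdy f) z)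

/-- `R_ζ(z) = Im z / |z - ζ|²`. -/
def Rfun (ζ : ℝ) (z : ℂ) : ℝ := z.im / ((z.re - ζ) ^ 2 + z.im ^ 2)

/-- `R_ζ^s(z)`, using the principal branch on the positive real `R_ζ(z)`. -/
def Rpow (s : ℂ) (ζ : ℝ) (z : ℂ) : ℂ := ((Rfun ζ z : ℝ) : ℂ) ^ s

/-- A Maass cusp form for `Γ₀(n)` with spectral parameter `s`. -/
structure IsCuspForm (n : ℕ) (s : ℂ) (u : ℂ → ℂ) : Prop where
  analytic : AnalyticOnNhd ℝ u {z : ℂ | 0 < z.im}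
  invar : ∀ g ∈ Gam0 n, ∀ z : ℂ, 0 < z.im → u (moeb g z) = u z
  eigen : ∀ z : ℂ, 0 < z.im → laplace u z = s * (1 - s) * u z
  decay : ∀ g : SL2, ∀ C : ℝ, ∃ K T : ℝ, ∀ z : ℂ, 0 < z.im → T ≤ z.im →
    ‖u (moeb g z)‖ ≤ K * z.im ^ C

/-- A vector valued cusp form for `Γ₀(n)` with spectral parameter `s`. -/
structure IsVVCuspForm (n : ℕ) {μ : ℕ} (α : Fin μ → SL2) (s : ℂ) (U : ℂ → Fin μ → ℂ) :
    Prop where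
  analytic : ∀ j, AnalyticOnNhd ℝ (fun z => U z j) {z : ℂ | 0 < z.im}
  equivar : ∀ g : SL2, ∀ z : ℂ, 0 < z.im → ∀ j,
    U (moeb g z) j = ∑ k, rho n α g j k * U z k
  eigen : ∀ j, ∀ z : ℂ, 0 < z.im → laplace (fun w => U w j) z = s * (1 - s) * U z j
  decay : ∀ j, ∀ C : ℝ, ∃ K T : ℝ, ∀ z : ℂ, 0 < z.im → T ≤ z.im → ‖U z j‖ ≤ K * z.im ^ C

/-- The map `Π` from cusp forms to vector valued cusp forms. -/
def PiMap {μ : ℕ} (α : Fin μ → SL2) (u : ℂ → ℂ) : ℂ → Fin μ → ℂ :=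
  fun z j => u (moeb (α j : Matrix (Fin 2) (Fin 2) ℤ) z)

/-- The integral transform `P`, componentwise:
`(Pu)(ζ) = ∫_0^∞ (u(iy) ∂_x R_ζ^s(iy) - R_ζ^s(iy) ∂_x u(iy)) dy`. -/
def Ptrans (s : ℂ) (v : ℂ → ℂ) (ζ : ℝ) : ℂ :=
  ∫ y in Set.Ioi (0 : ℝ),
    (v (y * Complex.I) * pdx (Rpow s ζ) (y * Complex.I)
      - Rpow s ζ (y * Complex.I) * pdx v (y * Complex.I))

def Tmat : SL2 := ⟨!![1, 1; 0, 1], by norm_num [Matrix.det_fin_two_of]⟩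

def Tmat' : SL2 := ⟨!![1, 0; 1, 1], by norm_num [Matrix.det_fin_two_of]⟩

/-- A (vector valued) period function for `Γ₀(n)` with spectral parameter `s`. -/
structure IsPeriodFn (n : ℕ) {μ : ℕ} (α : Fin μ → SL2) (s : ℂ) (ψ : ℝ → Fin μ → ℂ) :
    Prop where
  analytic : ∀ i, AnalyticOnNhd ℝ (fun ζ => ψ ζ i) (Set.Ioi 0)
  threeterm : ∀ ζ : ℝ, 0 < ζ → ∀ i,
    ψ ζ i = ∑ k, rho n α Tmat⁻¹ i k * ψ (ζ + 1) k
      + ((ζ + 1 : ℝ) : ℂ) ^ (-(2 * s)) * ∑ k, rho n α Tmat'⁻¹ i k * ψ (ζ / (ζ + 1)) k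
  grow0 : ∀ i, ∃ K ε : ℝ, 0 < ε ∧ ∀ ζ : ℝ, 0 < ζ → ζ < ε →
    ‖ψ ζ i‖ ≤ K * ζ ^ (max 0 (-2 * s.re))
  growInf : ∀ i, ∃ K T : ℝ, ∀ ζ : ℝ, T ≤ ζ → 0 < ζ →
    ‖ψ ζ i‖ ≤ K * ζ ^ (min 0 (-2 * s.re))


theorem Rat.max_num_den_div_le {a b : ℤ} (ha : a ≠ 0) (hb : 0 < b) {n : ℕ}
    (han : a.natAbs ≤ n) (hbn : b ≤ n) :
    max ((a : ℚ) / b).num.natAbs ((a : ℚ) / b).den ≤ n := by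
  rw [← Rat.divInt_eq_div]
  have hnum := Int.natAbs_dvd_natAbs.mpr (Rat.num_dvd a hb.ne')
  have hden := Int.le_of_dvd hb (Rat.den_dvd a b)
  have := Nat.le_of_dvd (Int.natAbs_pos.mpr ha) hnum
  omega

/-- Strictly between two positive rationals of the same level there is a rational whose level is
not larger. -/
theorem exists_between_of_level_eq {n : ℕ} {p q : ℚ} (hp : 0 < p) (hpq : p < q)
    (hpn : max p.num.natAbs p.den = n) (hqn : max q.num.natAbs q.den = n) :
    ∃ z : ℚ, p < z ∧ z < q ∧ max z.num.natAbs z.den ≤ n := by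
  have hc : 0 < p.num := Rat.num_pos.mpr hp
  have ha : 0 < q.num := Rat.num_pos.mpr (hp.trans hpq)
  have hd : 0 < p.den := p.pos
  have hb : 0 < q.den := q.pos
  have hpcop := p.reduced
  have hqcop := q.reduced
  have hpe : p = (p.num : ℚ) / p.den := (Rat.num_div_den p).symm
  have hqe : q = (q.num : ℚ) / q.den := (Rat.num_div_den q).symm
  have hd' : (0 : ℚ) < p.den := by exact_mod_cast hd
  have hb' : (0 : ℚ) < q.den := by exact_mod_cast hb
  rcases le_or_gt q 1 with hq1 | hq1
  · have hab : q.num ≤ q.den := by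
      rw [hqe, div_le_one hb'] at hq1; exact_mod_cast hq1
    have hcd : p.num < p.den := by
      have hp1 := hpq.trans_le hq1
      rw [hpe, div_lt_one hd'] at hp1; exact_mod_cast hp1
    have hbn : q.den = n := by omega
    have hdn : p.den = n := by omega
    have hca : p.num < q.num := by
      rw [hpe, hqe, hbn, hdn, div_lt_div_iff_of_pos_right (by rw [← hbn]; exact hb')] at hpq
      exact_mod_cast hpq
    have han : q.num.natAbs ≠ n := fun h => by
      rw [h, hbn, Nat.coprime_self] at hqcop; omega
    have hn1 : (0 : ℤ) < n - 1 := by omega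
    have hn1' : (0 : ℚ) < ((n - 1 : ℤ) : ℚ) := by exact_mod_cast hn1
    refine ⟨(p.num : ℚ) / (n - 1 : ℤ), ?_, ?_,
      Rat.max_num_den_div_le hc.ne' hn1 (by omega) (by omega)⟩
    · nth_rw 1 [hpe]
      rw [div_lt_div_iff₀ hd' hn1', hdn]
      have : p.num * (n - 1) < p.num * n := by nlinarith
      exact_mod_cast this
    · nth_rw 1 [hqe]
      rw [div_lt_div_iff₀ hn1' hb', hbn]
      have h1 : p.num + 1 ≤ q.num := hca
      have h2 : p.num + 2 ≤ n := by omega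
      have : p.num * n < q.num * (n - 1) := by nlinarith
      exact_mod_cast this
  rcases lt_or_ge p 1 with hp1 | hp1
  · exact ⟨1, hp1, hq1, by simp; omega⟩
  · have hdc : p.den ≤ p.num := by
      rw [hpe, one_le_div hd'] at hp1; exact_mod_cast hp1
    have hba : q.den < q.num := by
      rw [hqe, one_lt_div hb'] at hq1; exact_mod_cast hq1
    have hcn : p.num = n := by omega
    have han : q.num = n := by omega
    have hn : (0 : ℤ) < n := by omega
    have hbd : q.den < p.den := by
      rw [hpe, hqe, hcn, han, div_lt_div_iff_of_pos_left (by exact_mod_cast hn) hd' hb'] at hpq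
      exact_mod_cast hpq
    have hdn : p.den ≠ n := fun h => by
      rw [hcn, h, Int.natAbs_natCast, Nat.coprime_self] at hpcop; omega
    have hn1 : (0 : ℤ) < n - 1 := by omega
    refine ⟨((n - 1 : ℤ) : ℚ) / (q.den : ℤ), ?_, ?_,
      Rat.max_num_den_div_le hn1.ne' (by omega) (by omega) (by omega)⟩
    · nth_rw 1 [hpe]
      rw [Int.cast_natCast, div_lt_div_iff₀ hd' hb', hcn]
      have h1 : (q.den : ℤ) + 1 ≤ p.den := by omega
      have h2 : (q.den : ℤ) + 2 ≤ n := by omega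
      have : (n : ℤ) * q.den < (n - 1) * p.den := by nlinarith
      exact_mod_cast this
    · nth_rw 2 [hqe]
      rw [Int.cast_natCast, div_lt_div_iff_of_pos_right hb', han]
      exact_mod_cast sub_one_lt (n : ℤ)

theorem fareySet_finite (n : ℕ) : (fareySet n).Finite := by
  refine Set.Finite.union (by simp) ?_
  refine (((Set.finite_Icc (-(n : ℤ)) n).prod (Set.finite_Iic n)).image
    fun p : ℤ × ℕ => (((p.1 / p.2 : ℚ) : ℝ) : EReal)).subset ?_
  rintro _ ⟨q, rfl, h1, h2⟩
  exact ⟨(q.num, q.den), ⟨⟨by dsimp; omega, by dsimp; omega⟩, h2⟩,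
    by simp only [Rat.num_div_den]⟩

theorem coe_mem_fareySet_iff {q : ℚ} {n : ℕ} (hq : q ≠ 0) :
    ((q : ℝ) : EReal) ∈ fareySet n ↔ max q.num.natAbs q.den ≤ n := by
  simp [fareySet, hq]

theorem flev_coe {q : ℚ} (hq : q ≠ 0) :
    flev ((q : ℝ) : EReal) = max q.num.natAbs q.den := by
  simp only [flev, coe_mem_fareySet_iff hq]
  exact csInf_Ici

theorem flev_le {x : EReal} {n : ℕ} (h : x ∈ fareySet n) : flev x ≤ n := Nat.sInf_le h

theorem exists_rat_of_flev_pos {x : EReal} {n : ℕ} (hx : x ∈ fareySet n) (h : 0 < flev x) :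
    ∃ q : ℚ, x = ((q : ℝ) : EReal) ∧ q ≠ 0 ∧ flev x = max q.num.natAbs q.den := by
  rcases hx with hx | ⟨q, rfl, -⟩
  · exact absurd (flev_le (n := 0) (Or.inl hx)) h.not_ge
  · have hq : q ≠ 0 := by
      rintro rfl
      exact absurd (flev_le (n := 0) (Or.inl (by simp))) h.not_ge
    exact ⟨q, rfl, hq, flev_coe hq⟩

theorem fLN_mem {x : EReal} (hx : ⊥ < x) : fLN x ∈ fareySet (flev x) ∧ fLN x < x :=
  Set.Nonempty.csSup_mem (s := {r : EReal | r ∈ fareySet (flev x) ∧ r < x})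
    ⟨⊥, Or.inl (by simp), hx⟩ ((fareySet_finite _).subset fun _ h => h.1)

theorem le_fLN {x r : EReal} (hr : r ∈ fareySet (flev x)) (hrx : r < x) : r ≤ fLN x :=
  le_sSup ⟨hr, hrx⟩

/-- for `q ∈ ℚ ∪ {+∞}` with `lev q > 0`, `lev (LN q) < lev q`. -/
theorem stmt1 (x : EReal) (hx : (∃ q : ℚ, x = ((q : ℝ) : EReal)) ∨ x = ⊤)
    (hlev : 0 < flev x) : flev (fLN x) < flev x := by
  have hbot : ⊥ < x := by
    rcases hx with ⟨q, rfl⟩ | rfl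
    · exact EReal.bot_lt_coe _
    · exact bot_lt_top
  obtain ⟨hmem, hlt⟩ := fLN_mem hbot
  refine (flev_le hmem).lt_of_ne fun heq => ?_
  obtain ⟨q, hxq, hq0, hqn⟩ :=
    exists_rat_of_flev_pos (Nat.sInf_mem (Nat.nonempty_of_pos_sInf hlev)) hlev
  obtain ⟨p, hyp, hp0, hpn⟩ := exists_rat_of_flev_pos hmem (heq ▸ hlev)
  rw [heq] at hpn
  have hpq : p < q := by
    rw [hyp, hxq] at hlt; exact_mod_cast hlt
  have hgap : ∀ z : ℚ, p < z → z < q → ((z : ℝ) : EReal) ∉ fareySet (flev x) := by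
    intro z hpz hzq hz
    have hle := le_fLN hz (by rw [hxq]; exact_mod_cast hzq)
    rw [hyp] at hle
    exact hpz.not_ge (by exact_mod_cast hle)
  rcases hp0.lt_or_gt with hp | hp
  · rcases hq0.lt_or_gt with hq | hq
    · obtain ⟨z, hz1, hz2, hz⟩ := exists_between_of_level_eq (neg_pos.mpr hq)
        (neg_lt_neg hpq) (by simpa using hqn.symm) (by simpa using hpn.symm)
      have hz0 : -z ≠ 0 := by linarith
      exact hgap (-z) (by linarith) (by linarith)
        ((coe_mem_fareySet_iff hz0).mpr (by simpa using hz))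
    · exact hgap 0 hp hq (Or.inl (by simp))
  · obtain ⟨z, hz1, hz2, hz⟩ := exists_between_of_level_eq hp hpq hpn.symm hqn.symm
    exact hgap z hz1 hz2 ((coe_mem_fareySet_iff (hp.trans hz1).ne').mpr hz)


end
end

section
/- Let A = [[a, b], [0, d]] be an integer matrix with a ≥ 1, 0 ≤ b < d, and let M(b/d) = Σ_{l=1}^L m_l. Then for every l = 1, …, L the matrix m_l A = [[a b_l, b b_l − d a_l], [a b_{l−1}, b b_{l−1} − d a_{l−1}]] has only nonnegative integer entries. -/
noncomputable section

open Complex MeasureTheory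

theorem fLN_le (x : EReal) : fLN x ≤ x :=
  sSup_le fun _ hr => hr.2.le

theorem fLN_iterate_le (n : ℕ) (x : EReal) : fLN^[n] x ≤ x :=
  Function.iterate_le_id_of_le_id fLN_le n x

theorem eden_nonneg (x : EReal) : 0 ≤ eden x := by
  unfold eden
  split_ifs <;> simp

theorem eden_mul_sub_enum_mul_nonneg {b d : ℤ} (hd : 0 < d) {x : EReal}
    (hx : x ≤ ((((b : ℚ) / (d : ℚ) : ℚ) : ℝ) : EReal)) :
    0 ≤ eden x * b - enum x * d := by
  unfold eden enum
  split_ifs with h_bot h_top h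
  · simpa using hd.le
  · exact absurd (h_top ▸ hx) (not_le.mpr (EReal.coe_lt_top _))
  · have hr : h.choose ≤ (b : ℚ) / d := by
      rw [h.choose_spec] at hx
      exact_mod_cast EReal.coe_le_coe_iff.mp hx
    generalize h.choose = r at hr
    rw [← Rat.num_div_den r, div_le_div_iff₀ (by exact_mod_cast r.pos) (by exact_mod_cast hd)]
      at hr
    have hr' : r.num * d ≤ b * r.den := by exact_mod_cast hr
    linarith
  · simp

/-- for `A = [[a,b],[0,d]]` with `a ≥ 1`, `0 ≤ b < d` and
`M(b/d) = Σ_{l=1}^L m_l`, each matrix `m_l A` has only nonnegative entries. -/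
theorem stmt4 (a b d : ℤ) (ha : 1 ≤ a) (hb : 0 ≤ b) (hbd : b < d)
    (l : ℕ) (hl1 : 1 ≤ l) (hlL : l ≤ fL ((((b : ℚ) / (d : ℚ) : ℚ) : ℝ) : EReal)) :
    ∀ i j : Fin 2, 0 ≤ (mMat ((b : ℚ) / (d : ℚ)) l * !![a, b; 0, d]) i j := by
  have hy (k : ℕ) : 0 ≤ eden (yseq (b / d) k) * b - enum (yseq (b / d) k) * d :=
    eden_mul_sub_enum_mul_nonneg (hb.trans_lt hbd) (fLN_iterate_le _ _)
  have ha' : 0 ≤ a := zero_le_one.trans ha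
  intro i j
  fin_cases i <;> fin_cases j <;>
    simp [mMat, Matrix.mul_apply, Fin.sum_univ_two, mul_nonneg (eden_nonneg _) ha'] <;>
    linarith [hy l, hy (l - 1)]

end
end

section
/- Let A = [[a, b], [0, d]] be an integer matrix with a ≥ 1, 0 ≤ b < d, and let M(b/d) = Σ_{l=1}^L m_l. Then for every l = 1, …, L the entries of the matrix m_l A = [[a′, b′], [c′, d′]] satisfy a′ > c′ ≥ 0 and d′ > b′ ≥ 0. -/
noncomputable section

open Complex MeasureTheory

/-! ## Left neighbors of rationals in `[0, 1)` -/

theorem enum_bot : enum ⊥ = -1 := by simp [enum]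

theorem eden_bot : eden ⊥ = 0 := by simp [eden]

theorem enum_ratCast (q : ℚ) : enum ((q : ℝ) : EReal) = q.num := by
  have h : ∃ r : ℚ, ((q : ℝ) : EReal) = ((r : ℝ) : EReal) := ⟨q, rfl⟩
  have hs : q = h.choose := by exact_mod_cast h.choose_spec
  rw [enum, if_neg (EReal.coe_ne_bot _), if_neg (EReal.coe_ne_top _), dif_pos h, ← hs]

theorem eden_ratCast (q : ℚ) : eden ((q : ℝ) : EReal) = q.den := by
  have h : ∃ r : ℚ, ((q : ℝ) : EReal) = ((r : ℝ) : EReal) := ⟨q, rfl⟩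
  have hs : q = h.choose := by exact_mod_cast h.choose_spec
  rw [eden, if_neg (EReal.coe_ne_bot _), if_neg (EReal.coe_ne_top _), dif_pos h, ← hs]

theorem ratCast_mem_fareySet_iff {q : ℚ} {n : ℕ} :
    ((q : ℝ) : EReal) ∈ fareySet n ↔ q = 0 ∨ (q.num.natAbs ≤ n ∧ q.den ≤ n) := by
  constructor
  · rintro ((h | h | h) | ⟨r, h, h1, h2⟩)
    · exact absurd h (EReal.coe_ne_bot _)
    · exact absurd h (EReal.coe_ne_top _)
    · left
      exact_mod_cast Set.mem_singleton_iff.1 h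
    · have hr : q = r := by exact_mod_cast h
      exact Or.inr (hr ▸ ⟨h1, h2⟩)
  · rintro (rfl | h)
    · left
      simp
    · exact Or.inr ⟨q, rfl, h⟩

theorem exists_ratCast_of_mem_fareySet {n : ℕ} {x : EReal} (hx : x ∈ fareySet n)
    (hbot : x ≠ ⊥) (htop : x ≠ ⊤) : ∃ q : ℚ, x = ((q : ℝ) : EReal) := by
  rcases hx with (h | h | h) | ⟨r, h, -⟩
  · exact absurd h hbot
  · exact absurd h htop
  · exact ⟨0, by simpa using h⟩
  · exact ⟨r, h⟩

theorem num_natAbs_le_den {q : ℚ} (h0 : 0 ≤ q) (h1 : q < 1) : q.num.natAbs ≤ q.den := by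
  have := Rat.num_nonneg.2 h0
  have := Rat.num_lt_denom_iff.2 h1
  omega

theorem flev_zero : flev 0 = 0 := by
  have h : 0 ∈ {n : ℕ | (0 : EReal) ∈ fareySet n} := Or.inl (by simp)
  exact Nat.sInf_eq_zero.2 (Or.inl h)

theorem flev_ratCast {q : ℚ} (h0 : 0 < q) (h1 : q < 1) : flev ((q : ℝ) : EReal) = q.den := by
  refine IsLeast.csInf_eq ⟨?_, fun n hn => ?_⟩
  · exact ratCast_mem_fareySet_iff.2 (Or.inr ⟨num_natAbs_le_den h0.le h1, le_rfl⟩)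
  · exact ((ratCast_mem_fareySet_iff.1 hn).resolve_left h0.ne').2

theorem fLN_zero : fLN 0 = ⊥ := by
  refine sSup_eq_bot.2 fun x ⟨hx, hlt⟩ => ?_
  by_contra hbot
  obtain ⟨q, rfl⟩ := exists_ratCast_of_mem_fareySet hx hbot (hlt.trans_le le_top).ne
  rw [flev_zero] at hx
  rcases ratCast_mem_fareySet_iff.1 hx with rfl | ⟨-, h⟩
  · simp at hlt
  · exact q.den_pos.ne' (Nat.le_zero.1 h)

theorem exists_num_mul_sub_mul_den_eq_one {q : ℚ} (h0 : 0 < q) (h1 : q < 1) :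
    ∃ p v : ℤ, q.num * v - p * q.den = 1 ∧ 0 < v ∧ v < q.den ∧ 0 ≤ p := by
  have hn := Rat.num_pos.2 h0
  have hlt := Rat.num_lt_denom_iff.2 h1
  obtain ⟨s, t, hst⟩ :=
    Int.isCoprime_iff_gcd_eq_one.2 (show Int.gcd q.num q.den = 1 from q.reduced)
  have hdm := Int.emod_add_mul_ediv s q.den
  have hm0 := Int.emod_nonneg s (show (q.den : ℤ) ≠ 0 by omega)
  have hm1 := Int.emod_lt_of_pos s (show (0 : ℤ) < q.den by omega)
  have heq : q.num * (s % q.den) - (-(t + q.num * (s / q.den))) * q.den = 1 := by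
    linear_combination hst + q.num * hdm
  have hv : 0 < s % q.den := by
    refine lt_of_le_of_ne hm0 fun h => ?_
    rw [← h] at heq
    have hdvd : (q.den : ℤ) ∣ 1 := ⟨t + q.num * (s / q.den), by linear_combination -heq⟩
    have := Int.le_of_dvd one_pos hdvd
    omega
  refine ⟨_, _, heq, hv, hm1, ?_⟩
  by_contra! hneg
  nlinarith [mul_pos hn hv]

/-- The left neighbor of a rational in `(0, 1)` is the Farey parent on its left. -/
theorem fLN_ratCast {q : ℚ} (h0 : 0 < q) (h1 : q < 1) :
    ∃ r : ℚ, fLN ((q : ℝ) : EReal) = ((r : ℝ) : EReal) ∧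
      q.num * r.den - r.num * q.den = 1 ∧ r.den < q.den ∧ 0 ≤ r ∧ r < q := by
  obtain ⟨p, v, hdet, hv0, hvlt, hp⟩ := exists_num_mul_sub_mul_den_eq_one h0 h1
  have hcop : IsCoprime p v := ⟨-q.den, q.num, by linear_combination hdet⟩
  have hcop' := Int.isCoprime_iff_gcd_eq_one.1 hcop
  have hnum : ((p : ℚ) / v).num = p := Rat.num_div_eq_of_coprime hv0 hcop'
  have hden : (((p : ℚ) / v).den : ℤ) = v := Rat.den_div_eq_of_coprime hv0 hcop'
  generalize (p : ℚ) / v = r at hnum hden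
  subst hnum hden
  have hr0 : 0 ≤ r := Rat.num_nonneg.1 hp
  have hrq : r < q := (Rat.lt_iff _ _).2 (by linarith)
  refine ⟨r, IsGreatest.csSup_eq ⟨⟨?_, by exact_mod_cast hrq⟩, ?_⟩, hdet, by exact_mod_cast hvlt,
    hr0, hrq⟩
  · rw [flev_ratCast h0 h1]
    have := num_natAbs_le_den hr0 (hrq.trans h1)
    exact ratCast_mem_fareySet_iff.2 (Or.inr ⟨by omega, by omega⟩)
  · rintro x ⟨hx, hxq⟩
    by_cases hbot : x = ⊥
    · simp [hbot]
    obtain ⟨s, rfl⟩ := exists_ratCast_of_mem_fareySet hx hbot (hxq.trans_le le_top).ne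
    rw [flev_ratCast h0 h1] at hx
    have hsq : s < q := by exact_mod_cast hxq
    suffices s ≤ r by exact_mod_cast this
    rcases ratCast_mem_fareySet_iff.1 hx with rfl | ⟨-, hs⟩
    · exact hr0
    by_contra! hrs
    have e1 := (Rat.lt_iff _ _).1 hsq
    have e2 := (Rat.lt_iff _ _).1 hrs
    have e3 : (s.den : ℤ) = r.den * (q.num * s.den - s.num * q.den) +
        q.den * (s.num * r.den - r.num * s.den) := by
      linear_combination -(s.den : ℤ) * hdet
    have hs' : (s.den : ℤ) ≤ q.den := by exact_mod_cast hs
    nlinarith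

theorem fLN_enum_eden {q : ℚ} (h0 : 0 ≤ q) (h1 : q < 1) :
    q.num * eden (fLN ((q : ℝ) : EReal)) - enum (fLN ((q : ℝ) : EReal)) * q.den = 1 ∧
      0 ≤ eden (fLN ((q : ℝ) : EReal)) ∧ eden (fLN ((q : ℝ) : EReal)) < q.den := by
  rcases h0.eq_or_lt with rfl | h0
  · simp [fLN_zero, enum_bot, eden_bot]
  · obtain ⟨r, hr, hdet, hlt, -⟩ := fLN_ratCast h0 h1
    rw [hr, enum_ratCast, eden_ratCast]
    exact ⟨hdet, by omega, by exact_mod_cast hlt⟩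

/-- If `x₀/w₀` and `x/w` are right Farey partners of `p/v ≤ t` with `w ≤ v`, and `t < x₀/w₀`,
then `t < x/w`. -/
theorem mul_lt_of_det_eq_one {t : ℚ} {p v x w x₀ w₀ : ℤ} (hv : 0 < v) (h : x * v - p * w = 1)
    (h₀ : x₀ * v - p * w₀ = 1) (hw : w ≤ v) (hw₀ : 0 < w₀) (ht : p ≤ v * t)
    (hlt : w₀ * t < x₀) : w * t < x := by
  have hcop : IsCoprime v p := ⟨x, -w, by linear_combination h⟩
  obtain ⟨j, hj⟩ : v ∣ w₀ - w :=
    hcop.dvd_of_dvd_mul_left ⟨x₀ - x, by linear_combination h - h₀⟩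
  have hx : x₀ - x = j * p := by
    refine mul_right_cancel₀ hv.ne' ?_
    linear_combination h₀ - h + p * hj
  have hj0 : 0 ≤ j := by
    by_contra! hneg
    nlinarith
  have hjq : (0 : ℚ) ≤ j := by exact_mod_cast hj0
  have hxq : (x₀ : ℚ) - x = j * p := by exact_mod_cast hx
  have hwq : (w₀ : ℚ) - w = v * j := by exact_mod_cast hj
  have key : (w₀ - w) * t - (x₀ - x) = j * (v * t - p) := by rw [hxq, hwq]; ring
  nlinarith [mul_nonneg hjq (sub_nonneg.2 ht)]

theorem iterate_fLN_bounds {q : ℚ} (h0 : 0 ≤ q) (h1 : q < 1) (k : ℕ)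
    (hk : ∀ j ≤ k, fLN^[j] ((q : ℝ) : EReal) ≠ ⊥) :
    ∃ y : ℚ, fLN^[k] ((q : ℝ) : EReal) = ((y : ℝ) : EReal) ∧ 0 ≤ y ∧ y ≤ q ∧
      (y.den - eden (fLN ((y : ℝ) : EReal))) * q < y.num - enum (fLN ((y : ℝ) : EReal)) := by
  induction k with
  | zero =>
    refine ⟨q, rfl, h0, le_rfl, ?_⟩
    obtain ⟨hdet, -, -⟩ := fLN_enum_eden h0 h1
    have hd : (0 : ℚ) < q.den := by exact_mod_cast q.den_pos
    have hdet' : (q.num : ℚ) * eden (fLN ((q : ℝ) : EReal)) -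
        enum (fLN ((q : ℝ) : EReal)) * q.den = 1 := by exact_mod_cast hdet
    have hq : q * q.den = q.num := Rat.mul_den_eq_num q
    rw [← hq] at hdet' ⊢
    nlinarith
  | succ k ih =>
    obtain ⟨y, hy, hy0, hyq, hlt⟩ := ih fun j hj => hk j (by omega)
    have hstep : fLN^[k + 1] ((q : ℝ) : EReal) = fLN ((y : ℝ) : EReal) := by
      rw [Function.iterate_succ_apply', hy]
    have hypos : 0 < y := by
      refine lt_of_le_of_ne hy0 fun h => hk (k + 1) le_rfl ?_
      rw [hstep, ← h]
      simpa using fLN_zero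
    obtain ⟨r, hr, hdet, hden, hr0, hry⟩ := fLN_ratCast hypos (hyq.trans_lt h1)
    rw [hr, enum_ratCast, eden_ratCast] at hlt
    refine ⟨r, hstep.trans hr, hr0, hry.le.trans hyq, ?_⟩
    obtain ⟨hdet', hnn, -⟩ := fLN_enum_eden hr0 ((hry.le.trans hyq).trans_lt h1)
    have hrden : (0 : ℤ) < r.den := by exact_mod_cast r.den_pos
    have hrq : (r.num : ℚ) ≤ (r.den : ℤ) * q := by
      rw [← Rat.mul_den_eq_num r, mul_comm]
      exact mul_le_mul_of_nonneg_left (hry.le.trans hyq) (by positivity)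
    have := mul_lt_of_det_eq_one (t := q) (p := r.num) (v := r.den)
      (x := r.num - enum (fLN ((r : ℝ) : EReal))) (w := r.den - eden (fLN ((r : ℝ) : EReal)))
      (x₀ := y.num - r.num) (w₀ := y.den - r.den) hrden (by linear_combination hdet')
      (by linear_combination hdet) (by omega) (by omega) hrq (by push_cast; exact hlt)
    push_cast at this
    exact this

/-- for `A = [[a,b],[0,d]]` with `a ≥ 1`, `0 ≤ b < d` and
`M(b/d) = Σ_{l=1}^L m_l`, the entries of `m_l A = [[a',b'],[c',d']]` satisfy
`a' > c' ≥ 0` and `d' > b' ≥ 0`. -/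
theorem stmt5 (a b d : ℤ) (ha : 1 ≤ a) (hb : 0 ≤ b) (hbd : b < d)
    (l : ℕ) (hl1 : 1 ≤ l) (hlL : l ≤ fL ((((b : ℚ) / (d : ℚ) : ℚ) : ℝ) : EReal)) :
    (0 ≤ (mMat ((b : ℚ) / (d : ℚ)) l * !![a, b; 0, d]) 1 0 ∧
      (mMat ((b : ℚ) / (d : ℚ)) l * !![a, b; 0, d]) 1 0
        < (mMat ((b : ℚ) / (d : ℚ)) l * !![a, b; 0, d]) 0 0) ∧
    (0 ≤ (mMat ((b : ℚ) / (d : ℚ)) l * !![a, b; 0, d]) 0 1 ∧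
      (mMat ((b : ℚ) / (d : ℚ)) l * !![a, b; 0, d]) 0 1
        < (mMat ((b : ℚ) / (d : ℚ)) l * !![a, b; 0, d]) 1 1) := by
  have hd : (0 : ℚ) < d := by exact_mod_cast hb.trans_lt hbd
  have h0 : (0 : ℚ) ≤ (b : ℚ) / d := div_nonneg (by exact_mod_cast hb) hd.le
  have h1 : (b : ℚ) / d < 1 := (div_lt_one hd).2 (by exact_mod_cast hbd)
  have hqd : (b : ℚ) / d * d = b := div_mul_cancel₀ _ hd.ne'
  simp only [mMat, yseq]
  generalize (b : ℚ) / d = q at *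
  obtain ⟨y, hy, hy0, hyq, hlt⟩ := iterate_fLN_bounds h0 h1 (fL ((q : ℝ) : EReal) - l)
    fun j hj => Nat.notMem_of_lt_sInf (show j < fL ((q : ℝ) : EReal) by omega)
  obtain ⟨-, hnn, hden⟩ := fLN_enum_eden hy0 (hyq.trans_lt h1)
  rw [show fL ((q : ℝ) : EReal) - (l - 1) = fL ((q : ℝ) : EReal) - l + 1 by omega,
    Function.iterate_succ_apply', hy, enum_ratCast, eden_ratCast]
  generalize eden (fLN ((y : ℝ) : EReal)) = v at *
  generalize enum (fLN ((y : ℝ) : EReal)) = p at *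
  have hyden : (0 : ℚ) ≤ y.den := by positivity
  have hnum : (y.num : ℚ) * d ≤ y.den * b := by
    rw [← Rat.mul_den_eq_num y, ← hqd]
    nlinarith [mul_le_mul_of_nonneg_right hyq (mul_nonneg hyden hd.le)]
  have hnext : ((y.den : ℚ) - v) * b < (y.num - p) * d := by
    rw [← hqd]
    nlinarith [mul_lt_mul_of_pos_right hlt hd]
  have hnum' : y.num * d ≤ y.den * b := by exact_mod_cast hnum
  have hnext' : ((y.den : ℤ) - v) * b < (y.num - p) * d := by exact_mod_cast hnext
  simp [Matrix.mul_apply, Fin.sum_univ_two]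
  refine ⟨⟨by positivity, ?_⟩, ?_, ?_⟩ <;> nlinarith


end
end

section
/- Let m ≥ 1, let A ∈ X_m, and let g ∈ SL₂(ℤ). Then there exists a unique matrix A′ ∈ X_m such that A g (A′)^{−1} ∈ SL₂(ℤ) (equivalently, A g = γ A′ for some γ ∈ SL₂(ℤ)), and there exists a unique matrix A″ ∈ X_m such that A″ g A^{−1} ∈ SL₂(ℤ) (equivalently, A″ g = γ′ A for some γ′ ∈ SL₂(ℤ)). -/
noncomputable section

open Complex MeasureTheory

namespace FixedDetMatrices

/-- Every integral matrix of determinant `m ≠ 0` is left `SL₂(ℤ)`-equivalent to an element of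
`reps m`. -/
theorem exists_mem_reps_smul_eq {m : ℤ} (hm : m ≠ 0)
    (B : FixedDetMatrix (Fin 2) ℤ m) : ∃ R ∈ reps m, ∃ γ : SL2, B = γ • R := by
  induction B using induction_on hm with
  | h0 B h10 h00 h01 hlt => exact ⟨B, ⟨h10, h00, h01, hlt⟩, 1, (one_smul _ _).symm⟩
  | hS B ih =>
    obtain ⟨R, hR, γ, rfl⟩ := ih
    exact ⟨R, hR, ModularGroup.S * γ, (mul_smul _ _ _).symm⟩
  | hT B ih =>
    obtain ⟨R, hR, γ, rfl⟩ := ih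
    exact ⟨R, hR, ModularGroup.T * γ, (mul_smul _ _ _).symm⟩

end FixedDetMatrices

theorem det_eq_of_mem_Xset {m : ℕ} {A : Matrix (Fin 2) (Fin 2) ℤ} (hA : A ∈ Xset m) :
    A.det = m := by
  rw [Matrix.det_fin_two, hA.1, mul_zero, sub_zero, hA.2.1]

theorem exists_mem_Xset_eq_mul {m : ℕ} (hm : 1 ≤ m) {B : Matrix (Fin 2) (Fin 2) ℤ}
    (hB : B.det = m) :
    ∃ R ∈ Xset m, ∃ γ : SL2, B = (γ : Matrix (Fin 2) (Fin 2) ℤ) * R := by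
  obtain ⟨R, ⟨h10, h00, h01, hlt⟩, γ, h⟩ :=
    FixedDetMatrices.exists_mem_reps_smul_eq (by lia : (m : ℤ) ≠ 0) ⟨B, hB⟩
  have hmul : R.1 0 0 * R.1 1 1 = m := by
    have hdet := R.2
    rwa [Matrix.det_fin_two, h10, mul_zero, sub_zero] at hdet
  have h11 : 0 < R.1 1 1 := pos_of_mul_pos_right (by lia) h00.le
  rw [abs_of_nonneg h01, abs_of_pos h11] at hlt
  exact ⟨R.1, ⟨h10, hmul, h01, hlt⟩, γ, congrArg Subtype.val h⟩

/-- Distinct elements of `X_m` are inequivalent under left multiplication by `SL₂(ℤ)`. -/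
theorem eq_of_mem_Xset_of_eq_mul {m : ℕ} (hm : 1 ≤ m) {A B : Matrix (Fin 2) (Fin 2) ℤ}
    (hA : A ∈ Xset m) (hB : B ∈ Xset m) (γ : SL2)
    (h : A = (γ : Matrix (Fin 2) (Fin 2) ℤ) * B) : A = B := by
  obtain ⟨hA10, hA, hA01, hA11⟩ := hA
  obtain ⟨hB10, hB, hB01, hB11⟩ := hB
  have hγ := γ.det_coe
  rw [Matrix.det_fin_two] at hγ
  have hent (i j : Fin 2) : A i j = γ.1 i 0 * B 0 j + γ.1 i 1 * B 1 j := by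
    rw [h, Matrix.mul_apply, Fin.sum_univ_two]
  have hA00 : 0 < A 0 0 := pos_of_mul_pos_left (by lia) (hA01.trans hA11.le)
  have hB00 : 0 < B 0 0 := pos_of_mul_pos_left (by lia) (hB01.trans hB11.le)
  have h00 := hent 0 0
  have h01 := hent 0 1
  have h10 := hent 1 0
  have h11 := hent 1 1
  rw [hB10, mul_zero, add_zero] at h00 h10
  have hc : γ.1 1 0 = 0 := by
    rw [hA10] at h10
    exact (mul_eq_zero.mp h10.symm).resolve_right hB00.ne'
  rw [hc, mul_zero, sub_zero] at hγ
  have ha : 0 < γ.1 0 0 := pos_of_mul_pos_left (h00 ▸ hA00) hB00.le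
  have ha1 : γ.1 0 0 = 1 := Int.eq_one_of_mul_eq_one_right ha.le hγ
  rw [ha1, one_mul] at hγ h00 h01
  rw [hc, hγ, zero_mul, zero_add, one_mul] at h11
  have hb : A 0 1 = B 0 1 := by
    rw [← Int.emod_eq_of_lt hA01 hA11, ← Int.emod_eq_of_lt hB01 hB11, h01, h11,
      Int.add_mul_emod_self_right]
  rw [Matrix.eta_fin_two A, Matrix.eta_fin_two B, h00, hb, hA10, hB10, h11]

theorem existsUnique_mem_Xset_mul_eq_mul {m : ℕ} (hm : 1 ≤ m)
    {A : Matrix (Fin 2) (Fin 2) ℤ} (hA : A ∈ Xset m) (g : SL2) :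
    ∃! A' : Matrix (Fin 2) (Fin 2) ℤ, A' ∈ Xset m ∧
      ∃ γ : SL2, A * (g : Matrix (Fin 2) (Fin 2) ℤ)
        = (γ : Matrix (Fin 2) (Fin 2) ℤ) * A' := by
  have hdet : (A * (g : Matrix (Fin 2) (Fin 2) ℤ)).det = m := by
    rw [Matrix.det_mul, g.det_coe, mul_one, det_eq_of_mem_Xset hA]
  obtain ⟨R, hR, γ, h⟩ := exists_mem_Xset_eq_mul hm hdet
  refine ⟨R, ⟨hR, γ, h⟩, ?_⟩
  rintro R' ⟨hR', γ', h'⟩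
  refine eq_of_mem_Xset_of_eq_mul hm hR' hR (γ'⁻¹ * γ) ?_
  rw [Matrix.SpecialLinearGroup.coe_mul, mul_assoc, ← h, h', ← mul_assoc,
    ← Matrix.SpecialLinearGroup.coe_mul, inv_mul_cancel, Matrix.SpecialLinearGroup.coe_one,
    one_mul]

/-- Inverting both `SL₂(ℤ)` factors in `A * g = γ * B`. -/
theorem exists_mul_eq_mul_iff_inv (A B : Matrix (Fin 2) (Fin 2) ℤ) (g : SL2) :
    (∃ γ : SL2, A * (g : Matrix (Fin 2) (Fin 2) ℤ) = (γ : Matrix (Fin 2) (Fin 2) ℤ) * B) ↔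
      ∃ γ : SL2, B * ((g⁻¹ : SL2) : Matrix (Fin 2) (Fin 2) ℤ)
        = (γ : Matrix (Fin 2) (Fin 2) ℤ) * A := by
  have key (A B : Matrix (Fin 2) (Fin 2) ℤ) (g γ : SL2)
      (h : A * (g : Matrix (Fin 2) (Fin 2) ℤ) = (γ : Matrix (Fin 2) (Fin 2) ℤ) * B) :
      B * ((g⁻¹ : SL2) : Matrix (Fin 2) (Fin 2) ℤ)
        = ((γ⁻¹ : SL2) : Matrix (Fin 2) (Fin 2) ℤ) * A := by
    have hg : (g : Matrix (Fin 2) (Fin 2) ℤ) * (g⁻¹ : SL2) = 1 := by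
      rw [← Matrix.SpecialLinearGroup.coe_mul, mul_inv_cancel,
        Matrix.SpecialLinearGroup.coe_one]
    have hγ : ((γ⁻¹ : SL2) : Matrix (Fin 2) (Fin 2) ℤ) * γ = 1 := by
      rw [← Matrix.SpecialLinearGroup.coe_mul, inv_mul_cancel,
        Matrix.SpecialLinearGroup.coe_one]
    rw [← one_mul B, ← hγ, mul_assoc _ _ B, ← h, mul_assoc, mul_assoc, hg, mul_one]
  refine ⟨fun ⟨γ, h⟩ => ⟨γ⁻¹, key A B g γ h⟩, fun ⟨γ, h⟩ => ⟨γ⁻¹, ?_⟩⟩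
  simpa only [inv_inv] using key B A g⁻¹ γ h

/-- for `m ≥ 1`, `A ∈ X_m` and `g ∈ SL₂(ℤ)` there is a unique `A' ∈ X_m`
with `A g (A')⁻¹ ∈ SL₂(ℤ)` (i.e. `A g = γ A'` for some `γ ∈ SL₂(ℤ)`) and a unique
`A'' ∈ X_m` with `A'' g A⁻¹ ∈ SL₂(ℤ)` (i.e. `A'' g = γ' A` for some `γ' ∈ SL₂(ℤ)`). -/
theorem stmt6 (m : ℕ) (hm : 1 ≤ m) (A : Matrix (Fin 2) (Fin 2) ℤ) (hA : A ∈ Xset m)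
    (g : SL2) :
    (∃! A' : Matrix (Fin 2) (Fin 2) ℤ, A' ∈ Xset m ∧
      ∃ γ : SL2, A * (g : Matrix (Fin 2) (Fin 2) ℤ)
        = (γ : Matrix (Fin 2) (Fin 2) ℤ) * A') ∧
    (∃! A'' : Matrix (Fin 2) (Fin 2) ℤ, A'' ∈ Xset m ∧
      ∃ γ' : SL2, A'' * (g : Matrix (Fin 2) (Fin 2) ℤ)
        = (γ' : Matrix (Fin 2) (Fin 2) ℤ) * A) := by
  refine ⟨existsUnique_mem_Xset_mul_eq_mul hm hA g, ?_⟩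
  simpa only [exists_mul_eq_mul_iff_inv _ A g] using
    existsUnique_mem_Xset_mul_eq_mul hm hA g⁻¹

end
end

section
/- Let n ≥ 1, let m be a prime, let u ∈ S(n,s), and set 𝐀 = X_m if m ∤ n and 𝐀 = X_m ∖ {[[m,0],[0,1]]} if m | n. Then for every j ∈ {1, …, μ}: Σ_{A ∈ 𝐀} u((A α_j)·z) = Σ_{A ∈ 𝐀} u((α_{φ_A(j)} σ_{α_j}(A))·z) for all z ∈ ℍ; that is, Π(H_m u) = H_{n,m} Π(u), where Π(u) = (u(α_1 z), …, u(α_μ z)) and (H_{n,m} u⃗)_j = Σ_{A ∈ 𝐀} u_{φ_A(j)}|_0 σ_{α_j}(A). -/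
noncomputable section

open Complex MeasureTheory

lemma denom_ne_zero_of_det_pos {g : Matrix (Fin 2) (Fin 2) ℤ} (hg : 0 < g.det) {z : ℂ}
    (hz : 0 < z.im) : (g 1 0 : ℂ) * z + (g 1 1 : ℂ) ≠ 0 := by
  intro h
  have him := congrArg Complex.im h
  have hre := congrArg Complex.re h
  simp only [Complex.add_im, Complex.mul_im, Complex.intCast_re, Complex.intCast_im, zero_mul,
    add_zero, Complex.zero_im, mul_eq_zero, hz.ne', or_false] at him
  simp only [Complex.add_re, Complex.mul_re, Complex.intCast_re, Complex.intCast_im, zero_mul,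
    sub_zero, Complex.zero_re, him, zero_add] at hre
  rw [Matrix.det_fin_two, Int.cast_eq_zero.1 him, Int.cast_eq_zero.1 hre] at hg
  simp at hg

/-- The imaginary part of `moeb g z` is positive when `det g` and `Im z` are. -/
lemma moeb_im_pos {g : Matrix (Fin 2) (Fin 2) ℤ} (hg : 0 < g.det) {z : ℂ} (hz : 0 < z.im) :
    0 < (moeb g z).im := by
  have hne := denom_ne_zero_of_det_pos hg hz
  have hdet : (0 : ℝ) < g 0 0 * g 1 1 - g 0 1 * g 1 0 := by
    rw [Matrix.det_fin_two] at hg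
    exact_mod_cast hg
  have him : (moeb g z).im
      = (g 0 0 * g 1 1 - g 0 1 * g 1 0 : ℝ) * z.im
        / Complex.normSq ((g 1 0 : ℂ) * z + (g 1 1 : ℂ)) := by
    simp only [moeb, Complex.div_im, Complex.add_im, Complex.mul_im, Complex.intCast_re,
      Complex.intCast_im, Complex.add_re, Complex.mul_re]
    ring
  rw [him]
  exact div_pos (mul_pos hdet hz) (Complex.normSq_pos.2 hne)

/-- `moeb` is multiplicative on matrices of positive determinant. -/
lemma moeb_mul {g h : Matrix (Fin 2) (Fin 2) ℤ} (hg : 0 < g.det) (hh : 0 < h.det) {z : ℂ}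
    (hz : 0 < z.im) : moeb (g * h) z = moeb g (moeb h z) := by
  have h₁ := denom_ne_zero_of_det_pos hh hz
  have h₂ := denom_ne_zero_of_det_pos hg (moeb_im_pos hh hz)
  have h₃ := denom_ne_zero_of_det_pos (g := g * h)
    (by rw [Matrix.det_mul]; exact mul_pos hg hh) hz
  rw [moeb, moeb, div_eq_div_iff h₃ h₂]
  simp only [moeb, Matrix.mul_apply, Fin.sum_univ_two, Int.cast_add, Int.cast_mul]
  field_simp
  ring

lemma det_of_mem_XF {m : ℕ} {A : Matrix (Fin 2) (Fin 2) ℤ} (hA : A ∈ XF m) : A.det = m := by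
  simp only [XF, Finset.mem_image, Finset.mem_filter, Finset.mem_product] at hA
  obtain ⟨p, ⟨⟨hp, -⟩, -⟩, rfl⟩ := hA
  rw [Matrix.det_fin_two_of, mul_zero, sub_zero]
  exact_mod_cast Nat.div_mul_cancel (Nat.dvd_of_mem_divisors hp)

/-- `Π(H_m u) = H_{n,m} Π(u)` for a cusp form `u ∈ S(n,s)` and a prime
`m`, with `𝐀 = X_m` if `m ∤ n` and `𝐀 = X_m ∖ {[[m,0],[0,1]]}` if `m ∣ n`:
componentwise `Σ_{A ∈ 𝐀} u((A α_j)z) = Σ_{A ∈ 𝐀} u((α_{φ_A(j)} σ_{α_j}(A))z)`. -/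
theorem stmt10 (n : ℕ) (hn : 1 ≤ n) (m : ℕ) (hm : m.Prime) (s : ℂ) (μ : ℕ)
    (α : Fin μ → SL2) (hrep : IsCosetReps n α)
    (u : ℂ → ℂ) (hu : IsCuspForm n s u)
    (σ : Fin μ → Matrix (Fin 2) (Fin 2) ℤ → Matrix (Fin 2) (Fin 2) ℤ)
    (hσ : ∀ j : Fin μ, ∀ A ∈ XF m, σ j A ∈ XF m ∧
      ∃ γ : SL2, A * (α j : Matrix (Fin 2) (Fin 2) ℤ)
        = (γ : Matrix (Fin 2) (Fin 2) ℤ) * σ j A)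
    (φ : Matrix (Fin 2) (Fin 2) ℤ → Fin μ → Fin μ)
    (hφ : ∀ A ∈ XF m, ∀ j : Fin μ, ∃ γ : SL2, γ ∈ Gam0 n ∧
      A * (α j : Matrix (Fin 2) (Fin 2) ℤ)
        = (γ : Matrix (Fin 2) (Fin 2) ℤ) * (α (φ A j) : Matrix (Fin 2) (Fin 2) ℤ) * σ j A) :
    ∀ (j : Fin μ) (z : ℂ), 0 < z.im →
      (∑ A ∈ (if m ∣ n then (XF m).erase !![(m : ℤ), 0; 0, 1] else XF m),
        u (moeb (A * (α j : Matrix (Fin 2) (Fin 2) ℤ)) z))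
      = ∑ A ∈ (if m ∣ n then (XF m).erase !![(m : ℤ), 0; 0, 1] else XF m),
          u (moeb ((α (φ A j) : Matrix (Fin 2) (Fin 2) ℤ) * σ j A) z) := by
  intro j z hz
  refine Finset.sum_congr rfl fun A hA => ?_
  have hAX : A ∈ XF m := by
    split_ifs at hA
    · exact Finset.mem_of_mem_erase hA
    · exact hA
  obtain ⟨γ, hγ, heq⟩ := hφ A hAX j
  have hdet : 0 < ((α (φ A j) : Matrix (Fin 2) (Fin 2) ℤ) * σ j A).det := by
    rw [Matrix.det_mul, (α (φ A j)).det_coe, one_mul, det_of_mem_XF (hσ j A hAX).1]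
    exact_mod_cast hm.pos
  rw [heq, mul_assoc, moeb_mul (by rw [γ.det_coe]; exact one_pos) hdet hz,
    hu.invar γ hγ _ (moeb_im_pos hdet hz)]

end
end
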